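/- Let A ⋊_σ G be a skew group ring where G is an abelian group. Then A ⋊_σ G is a simple ring if and only if A is G-simple and Z(A ⋊_σ G) is a field. -/

import Mathlib

/-- `R`, together with a ring embedding `ι : A →+* R` and a family `u : G → R` of
distinguished elements, is a skew group ring `A ⋊_σ G`: the `u g` satisfy
`u 1 = 1`, `u g * u h = u (g * h)`, the twisted commutation rule
`u g * ι a = ι (σ g a) * u g` (which forces `(a u_g)(b u_h) = a σ_g(b) u_{gh}`),
and `R` is a free left `A`-module with basis `{u g}_{g ∈ G}`, i.e. every element
of `R` is uniquely a finite sum `∑ a_g u_g`. -/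
def IsSkewGroupRing {A G R : Type*} [Ring A] [Group G] [Ring R]
    (σ : G →* RingAut A) (ι : A →+* R) (u : G → R) : Prop :=
  u 1 = 1 ∧
  (∀ g h : G, u g * u h = u (g * h)) ∧
  (∀ (g : G) (a : A), u g * ι a = ι (σ g a) * u g) ∧
  (∀ r : R, ∃! f : G →₀ A, r = f.sum fun g a => ι a * u g)

/-- `A` is `G`-simple: the only `G`-invariant (two-sided) ideals of `A` are `{0}` and `A`. -/
def IsGSimple {A G : Type*} [Ring A] [Group G] (σ : G →* RingAut A) : Prop :=
  ∀ I : TwoSidedIdeal A, (∀ (g : G) (a : A), a ∈ I → σ g a ∈ I) → I = ⊥ ∨ I = ⊤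

namespace IsSkewGroupRing

section

variable {A G R : Type*} [Ring A] [Ring R] {ι : A →+* R} {u : G → R}

/-- The additive map `∑ a_g g ↦ ∑ a_g u_g`. -/
noncomputable def ofCoeff (ι : A →+* R) (u : G → R) : (G →₀ A) →+ R :=
  Finsupp.liftAddHom fun g => (AddMonoidHom.mulRight (u g)).comp ι.toAddMonoidHom

theorem ofCoeff_apply (f : G →₀ A) : ofCoeff ι u f = f.sum fun g a => ι a * u g := rfl

theorem ofCoeff_single (g : G) (a : A) : ofCoeff ι u (Finsupp.single g a) = ι a * u g := by
  simp [ofCoeff_apply]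

end

section

variable {A G R : Type*} [Ring A] [Group G] [Ring R] {σ : G →* RingAut A} {ι : A →+* R}
  {u : G → R}

theorem ofCoeff_bijective (h : IsSkewGroupRing σ ι u) : Function.Bijective (ofCoeff ι u) := by
  rw [Function.bijective_iff_existsUnique]
  intro r
  simpa only [ofCoeff_apply, eq_comm] using h.2.2.2 r

/-- The coefficients of an element of a skew group ring. -/
noncomputable def coeff (h : IsSkewGroupRing σ ι u) : R ≃+ (G →₀ A) :=
  (AddEquiv.ofBijective (ofCoeff ι u) h.ofCoeff_bijective).symm

theorem coeff_ι_mul_u (h : IsSkewGroupRing σ ι u) (a : A) (g : G) :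
    h.coeff (ι a * u g) = Finsupp.single g a := by
  rw [coeff, AddEquiv.symm_apply_eq]
  exact (ofCoeff_single g a).symm

theorem coeff_ι (h : IsSkewGroupRing σ ι u) (a : A) : h.coeff (ι a) = Finsupp.single 1 a := by
  simpa [h.1] using h.coeff_ι_mul_u a 1

theorem coeff_one (h : IsSkewGroupRing σ ι u) : h.coeff 1 = Finsupp.single 1 1 := by
  simpa using h.coeff_ι 1

theorem induction_on (h : IsSkewGroupRing σ ι u) {p : R → Prop} (r : R) (zero : p 0)
    (add : ∀ x y, p x → p y → p (x + y)) (mul : ∀ a g, p (ι a * u g)) : p r := by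
  obtain ⟨f, rfl⟩ := h.ofCoeff_bijective.surjective r
  induction f using Finsupp.induction_linear with
  | zero => simpa using zero
  | add x y hx hy => simpa using add _ _ hx hy
  | single g a => simpa [ofCoeff_single] using mul a g

theorem coeff_ι_mul (h : IsSkewGroupRing σ ι u) (b : A) (r : R) (g : G) :
    h.coeff (ι b * r) g = b * h.coeff r g := by
  classical
  induction r using h.induction_on with
  | zero => simp
  | add x y hx hy => simp [mul_add, hx, hy]
  | mul a k =>
    rw [← mul_assoc, ← map_mul, coeff_ι_mul_u, coeff_ι_mul_u]
    by_cases hk : k = g <;> simp [hk]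

theorem coeff_mul_ι (h : IsSkewGroupRing σ ι u) (r : R) (b : A) (g : G) :
    h.coeff (r * ι b) g = h.coeff r g * σ g b := by
  classical
  induction r using h.induction_on with
  | zero => simp
  | add x y hx hy => simp [add_mul, hx, hy]
  | mul a k =>
    rw [mul_assoc, h.2.2.1, ← mul_assoc, ← map_mul, coeff_ι_mul_u, coeff_ι_mul_u]
    by_cases hk : k = g <;> simp [hk]

theorem coeff_mul_u (h : IsSkewGroupRing σ ι u) (r : R) (k g : G) :
    h.coeff (r * u k) g = h.coeff r (g * k⁻¹) := by
  classical
  induction r using h.induction_on with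
  | zero => simp
  | add x y hx hy => simp [add_mul, hx, hy]
  | mul a l =>
    rw [mul_assoc, h.2.1, coeff_ι_mul_u, coeff_ι_mul_u]
    simp [Finsupp.single_apply, eq_mul_inv_iff_mul_eq]

theorem coeff_u_mul (h : IsSkewGroupRing σ ι u) (r : R) (k g : G) :
    h.coeff (u k * r) g = σ k (h.coeff r (k⁻¹ * g)) := by
  classical
  induction r using h.induction_on with
  | zero => simp
  | add x y hx hy => simp [mul_add, hx, hy]
  | mul a l =>
    rw [← mul_assoc, h.2.2.1, mul_assoc, h.2.1, coeff_ι_mul_u, coeff_ι_mul_u]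
    by_cases hk : k * l = g
    · simp [← hk]
    · simp [eq_inv_mul_iff_mul_eq, hk]

theorem ext (h : IsSkewGroupRing σ ι u) {r s : R} (hrs : ∀ g, h.coeff r g = h.coeff s g) :
    r = s :=
  h.coeff.injective (Finsupp.ext hrs)

/-- The elements of a skew group ring whose coefficients lie in a given `G`-invariant ideal. -/
noncomputable def extendIdeal (h : IsSkewGroupRing σ ι u) (I : TwoSidedIdeal A)
    (hI : ∀ (g : G) (a : A), a ∈ I → σ g a ∈ I) : TwoSidedIdeal R :=
  .mk' {r | ∀ g, h.coeff r g ∈ I}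
    (by simp [I.zero_mem])
    (fun hx hy g => by simpa using I.add_mem (hx g) (hy g))
    (fun hx g => by simpa using I.neg_mem (hx g))
    (fun {s r} hr => by
      induction s using h.induction_on with
      | zero => simp [I.zero_mem]
      | add x y hx hy => intro g; simpa [add_mul] using I.add_mem (hx g) (hy g)
      | mul b k =>
        intro g
        rw [mul_assoc, coeff_ι_mul, coeff_u_mul]
        exact I.mul_mem_left _ _ (hI _ _ (hr _)))
    (fun {r s} hr => by
      induction s using h.induction_on with
      | zero => simp [I.zero_mem]
      | add x y hx hy => intro g; simpa [mul_add] using I.add_mem (hx g) (hy g)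
      | mul b k =>
        intro g
        rw [← mul_assoc, coeff_mul_u, coeff_mul_ι]
        exact I.mul_mem_right _ _ (hr _))

theorem mem_extendIdeal (h : IsSkewGroupRing σ ι u) {I : TwoSidedIdeal A}
    {hI : ∀ (g : G) (a : A), a ∈ I → σ g a ∈ I} {r : R} :
    r ∈ h.extendIdeal I hI ↔ ∀ g, h.coeff r g ∈ I :=
  TwoSidedIdeal.mem_mk' ..

theorem isGSimple (h : IsSkewGroupRing σ ι u) [IsSimpleRing R] : IsGSimple σ := by
  classical
  intro I hI
  rcases eq_bot_or_eq_top (h.extendIdeal I hI) with hK | hK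
  · refine .inl (le_bot_iff.1 fun a ha => ?_)
    have hmem : ι a ∈ h.extendIdeal I hI := by
      rw [mem_extendIdeal]
      intro g
      rw [coeff_ι, Finsupp.single_apply]
      split_ifs
      exacts [ha, I.zero_mem]
    rw [hK, TwoSidedIdeal.mem_bot] at hmem
    rw [TwoSidedIdeal.mem_bot]
    simpa [hmem] using (DFunLike.congr_fun (h.coeff_ι a) 1).symm
  · refine .inr (I.one_mem_iff.1 ?_)
    have hmem : (1 : R) ∈ h.extendIdeal I hI := hK ▸ TwoSidedIdeal.mem_top R
    simpa [coeff_one] using h.mem_extendIdeal.1 hmem 1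

theorem mem_center_of_commute (h : IsSkewGroupRing σ ι u) {x : R} (hι : ∀ a, Commute (ι a) x)
    (hu : ∀ g, Commute (u g) x) : x ∈ Subring.center R := by
  rw [Subring.mem_center_iff]
  intro r
  induction r using h.induction_on with
  | zero => simp
  | add y z hy hz => rw [add_mul, mul_add, hy, hz]
  | mul a g => exact ((hι a).mul_left (hu g)).eq

end

section

variable {A G R : Type*} [Ring A] [CommGroup G] [Ring R] {σ : G →* RingAut A} {ι : A →+* R}
  {u : G → R}

theorem coeff_conj (h : IsSkewGroupRing σ ι u) (r : R) (k g : G) :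
    h.coeff (u k * r * u k⁻¹) g = σ k (h.coeff r g) := by
  rw [coeff_mul_u, coeff_u_mul, inv_inv, mul_comm g, inv_mul_cancel_left]

/-- The coefficients at `1` of the elements of an ideal supported in `S`. -/
noncomputable def coeffIdeal (h : IsSkewGroupRing σ ι u) (J : TwoSidedIdeal R) (S : Set G) :
    TwoSidedIdeal A :=
  .mk' {a | ∃ x ∈ J, (∀ g ∉ S, h.coeff x g = 0) ∧ h.coeff x 1 = a}
    ⟨0, J.zero_mem, by simp, by simp⟩
    (by
      rintro _ _ ⟨x, hx, hxS, rfl⟩ ⟨y, hy, hyS, rfl⟩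
      exact ⟨x + y, J.add_mem hx hy, fun g hg => by simp [hxS g hg, hyS g hg], by simp⟩)
    (by
      rintro _ ⟨x, hx, hxS, rfl⟩
      exact ⟨-x, J.neg_mem hx, fun g hg => by simp [hxS g hg], by simp⟩)
    (by
      rintro b _ ⟨x, hx, hxS, rfl⟩
      exact ⟨ι b * x, J.mul_mem_left _ _ hx, fun g hg => by simp [coeff_ι_mul, hxS g hg],
        h.coeff_ι_mul ..⟩)
    (by
      rintro _ b ⟨x, hx, hxS, rfl⟩
      exact ⟨x * ι b, J.mul_mem_right _ _ hx, fun g hg => by simp [coeff_mul_ι, hxS g hg],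
        by simp [coeff_mul_ι]⟩)

theorem mem_coeffIdeal (h : IsSkewGroupRing σ ι u) {J : TwoSidedIdeal R} {S : Set G} {a : A} :
    a ∈ h.coeffIdeal J S ↔ ∃ x ∈ J, (∀ g ∉ S, h.coeff x g = 0) ∧ h.coeff x 1 = a :=
  TwoSidedIdeal.mem_mk' ..

theorem map_mem_coeffIdeal (h : IsSkewGroupRing σ ι u) {J : TwoSidedIdeal R} {S : Set G} (k : G)
    {a : A} (ha : a ∈ h.coeffIdeal J S) : σ k a ∈ h.coeffIdeal J S := by
  obtain ⟨x, hx, hxS, rfl⟩ := h.mem_coeffIdeal.1 ha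
  exact h.mem_coeffIdeal.2 ⟨u k * x * u k⁻¹, J.mul_mem_right _ _ (J.mul_mem_left _ _ hx),
    fun g hg => by simp [coeff_conj, hxS g hg], h.coeff_conj ..⟩

theorem exists_minimal_support (h : IsSkewGroupRing σ ι u) {J : TwoSidedIdeal R} (hJ : J ≠ ⊥) :
    ∃ r ∈ J, h.coeff r 1 ≠ 0 ∧
      ∀ s ∈ J, (h.coeff s).support.card < (h.coeff r).support.card → s = 0 := by
  have hne : ∃ r ∈ J, r ≠ 0 := by
    by_contra! H
    exact hJ (le_bot_iff.1 fun r hr => (TwoSidedIdeal.mem_bot R).2 (H r hr))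
  obtain ⟨r, ⟨hr, hr0⟩, hmin⟩ := exists_minimalFor_of_wellFoundedLT
    (fun r => r ∈ J ∧ r ≠ 0) (fun r => (h.coeff r).support.card) hne
  obtain ⟨k, hk⟩ : ∃ k, h.coeff r k ≠ 0 := by
    by_contra! H
    exact hr0 (h.ext fun g => by simp [H])
  refine ⟨r * u k⁻¹, J.mul_mem_right _ _ hr, by simpa [coeff_mul_u] using hk, fun s hs hlt => ?_⟩
  by_contra hs0
  have hle : (h.coeff (r * u k⁻¹)).support.card ≤ (h.coeff r).support.card :=
    Finset.card_le_card_of_injOn (· * k) (fun g hg => by simpa [coeff_mul_u] using hg)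
      (mul_left_injective k).injOn
  exact absurd (hmin ⟨hs, hs0⟩ (hlt.le.trans hle)) (hlt.trans_le hle).not_ge

/-- Every nonzero ideal of a skew group ring by an abelian group contains a nonzero central
element if the coefficient ring is `G`-simple. -/
theorem exists_mem_center (h : IsSkewGroupRing σ ι u) (hA : IsGSimple σ) {J : TwoSidedIdeal R}
    (hJ : J ≠ ⊥) : ∃ x ∈ J, x ≠ 0 ∧ x ∈ Subring.center R := by
  obtain ⟨r, hr, hr1, hmin⟩ := h.exists_minimal_support hJ
  have hrI : h.coeff r 1 ∈ h.coeffIdeal J (h.coeff r).support :=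
    h.mem_coeffIdeal.2 ⟨r, hr, fun g hg => by simpa using hg, rfl⟩
  have htop : h.coeffIdeal J (h.coeff r).support = ⊤ := by
    refine (hA _ fun g a => h.map_mem_coeffIdeal g).resolve_left fun hbot => hr1 ?_
    rwa [hbot, TwoSidedIdeal.mem_bot] at hrI
  obtain ⟨x, hx, hxS, hx1⟩ := h.mem_coeffIdeal.1 ((TwoSidedIdeal.one_mem_iff _).2 htop)
  have eq_zero {s : R} (hs : s ∈ J) (hsS : ∀ g ∉ (h.coeff r).support, h.coeff s g = 0)
      (hs1 : h.coeff s 1 = 0) : s = 0 := by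
    refine hmin s hs (Finset.card_lt_card (Finset.ssubset_iff_of_subset (fun g hg => ?_) |>.2
      ⟨1, by simpa using hr1, by simpa using hs1⟩))
    by_contra hg'
    exact Finsupp.mem_support_iff.1 hg (hsS g hg')
  refine ⟨x, hx, ?_, h.mem_center_of_commute (fun a => ?_) fun k => ?_⟩
  · rintro rfl
    apply hr1
    rw [← mul_one (h.coeff r 1), ← hx1]
    simp
  · refine sub_eq_zero.1 (eq_zero (J.sub_mem (J.mul_mem_left _ _ hx) (J.mul_mem_right _ _ hx))
      (fun g hg => ?_) ?_)
    · simp [coeff_ι_mul, coeff_mul_ι, hxS g hg]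
    · simp [coeff_ι_mul, coeff_mul_ι, hx1]
  · have hconj : u k * x * u k⁻¹ = x := by
      refine sub_eq_zero.1 (eq_zero
        (J.sub_mem (J.mul_mem_right _ _ (J.mul_mem_left _ _ hx)) hx) (fun g hg => ?_) ?_)
      · simp [coeff_conj, hxS g hg]
      · simp [coeff_conj, hx1]
    have hcomm : u k * x = u k * x * u k⁻¹ * u k := by
      rw [mul_assoc _ (u k⁻¹), h.2.1, inv_mul_cancel, h.1, mul_one]
    rw [hconj] at hcomm
    exact hcomm

end

end IsSkewGroupRing

/-- **Theorem 1.2(c).** A skew group ring `A ⋊_σ G` of an abelian group `G` is simple if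
and only if `A` is `G`-simple and the centre `Z(A ⋊_σ G)` is a field. -/
theorem simple_iff_gSimple_and_center_isField {A G R : Type*} [Ring A] [CommGroup G]
    [Ring R] (σ : G →* RingAut A) (ι : A →+* R) (u : G → R)
    (h : IsSkewGroupRing σ ι u) :
    IsSimpleRing R ↔ IsGSimple σ ∧ IsField (Subring.center R) := by
  constructor
  · intro _
    exact ⟨h.isGSimple, IsSimpleRing.isField_center R⟩
  · rintro ⟨hA, hZ⟩
    have : Nontrivial R := by
      obtain ⟨x, y, hxy⟩ := hZ.exists_pair_ne
      exact ⟨x, y, fun H => hxy (Subtype.ext H)⟩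
    refine ⟨⟨fun J => or_iff_not_imp_left.2 fun hJ => J.one_mem_iff.1 ?_⟩⟩
    obtain ⟨x, hx, hx0, hxZ⟩ := h.exists_mem_center hA hJ
    obtain ⟨y, hy⟩ := hZ.mul_inv_cancel (a := ⟨x, hxZ⟩) fun H => hx0 (congrArg Subtype.val H)
    have hxy : x * y = 1 := congrArg Subtype.val hy
    exact hxy ▸ J.mul_mem_right _ _ hx
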